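/- Suppose f is (L₀,L₁)-smooth and bounded below by f*, β ∈ [0,1), and η ≤ (1−β)²/(L₁√d). Then for the AdaGrad-with-momentum iterates, for any t ≥ 1: Σ_{s=1}^t ⟨∇f(x_s) − ∇f(y_s), g_s/b_s⟩ ≤ Σ_{s=1}^t (𝓛_s/(2η))·‖m_{s−1}‖² + Σ_{s=1}^t (𝓛_s·η/(2(1−β)²))·Σ_{i=1}^d g_{s,i}²/b_{s,i}², where g_s/b_s denotes the coordinatewise quotient. -/

import Mathlib

open MeasureTheory Finset Real

/-- Along an `(L₀, L₁)`-smooth function bounded below, the local smoothness constant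
`L₀ + L₁ ‖∇f(p)‖` is controlled by the function value gap. -/
theorem local_smoothness_le_of_bddBelow {E : Type*} [NormedAddCommGroup E]
    [InnerProductSpace ℝ E] [CompleteSpace E] {f : E → ℝ} {f' : E → E}
    (hf : ∀ p, HasGradientAt f (f' p) p) {L₀ L₁ : ℝ} (hL₀ : 0 < L₀) (hL₁ : 0 < L₁)
    (hsmooth : ∀ p q, ‖p - q‖ ≤ 1 / L₁ →
      ‖f' q - f' p‖ ≤ (L₀ + L₁ * ‖f' p‖) * ‖p - q‖)
    {c : ℝ} (hc : ∀ p, c ≤ f p) (p : E) :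
    L₀ + L₁ * ‖f' p‖ ≤
      2 * L₀ + 2 * L₁ * (4 * L₁ * (f p - c) + √(4 * L₀ * (f p - c))) := by
  set G := ‖f' p‖ with hG
  have hG0 : 0 ≤ G := norm_nonneg _
  set K := L₀ + L₁ * G with hK
  have hK0 : 0 < K := by positivity
  set h := 1 / (2 * K) with hh
  have hh0 : 0 < h := by positivity
  have hKh : K * h = 1 / 2 := by rw [hh]; field_simp
  have hstep : h * G ≤ 1 / L₁ := by
    rw [le_div_iff₀ hL₁]
    nlinarith [mul_pos hh0 hL₀]
  have hline (t : ℝ) : HasDerivAt (fun t : ℝ => p - (t * h) • f' p) (-(h • f' p)) t := by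
    simpa using (((hasDerivAt_id t).mul_const h).smul_const (f' p)).const_sub p
  have hderiv (t : ℝ) : HasDerivAt (fun t : ℝ => f (p - (t * h) • f' p))
      (inner ℝ (f' (p - (t * h) • f' p)) (-(h • f' p))) t := by
    have := (hf (p - (t * h) • f' p)).hasFDerivAt.comp_hasDerivAt t (hline t)
    simp only [InnerProductSpace.toDual_apply_apply] at this
    exact this
  obtain ⟨t, ⟨ht0, ht1⟩, ht⟩ := exists_hasDerivAt_eq_slope _ _ zero_lt_one
    (fun t _ => (hderiv t).continuousAt.continuousWithinAt) (fun t _ => hderiv t)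
  simp only [one_mul, zero_mul, zero_smul, sub_zero, div_one] at ht
  set q := p - (t * h) • f' p with hq
  have hpq : ‖p - q‖ = t * (h * G) := by
    rw [hq, sub_sub_cancel, norm_smul, Real.norm_of_nonneg (by positivity), ← hG, mul_assoc]
  have hpq' : ‖p - q‖ ≤ h * G := by
    rw [hpq]
    exact mul_le_of_le_one_left (by positivity) ht1.le
  have hdiff : ‖f' q - f' p‖ ≤ G / 2 := by
    calc ‖f' q - f' p‖ ≤ K * ‖p - q‖ := hsmooth p q (hpq'.trans hstep)
      _ ≤ K * (h * G) := by gcongr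
      _ = G / 2 := by rw [← mul_assoc, hKh]; ring
  have hinner : -(G / 2 * G) ≤ inner ℝ (f' q - f' p) (f' p) := by
    have h1 := abs_le.mp (abs_real_inner_le_norm (f' q - f' p) (f' p))
    have h2 : ‖f' q - f' p‖ * ‖f' p‖ ≤ G / 2 * G := by gcongr
    linarith [h1.1]
  rw [inner_sub_left, real_inner_self_eq_norm_sq, ← hG] at hinner
  rw [inner_neg_right, real_inner_smul_right] at ht
  have hgap : G ^ 2 ≤ 4 * K * (f p - c) := by
    have h1 : h * (G ^ 2 / 2) ≤ f p - c := by
      have h2 := mul_le_mul_of_nonneg_left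
        (show G ^ 2 / 2 ≤ inner ℝ (f' q) (f' p) by linarith) hh0.le
      linarith [hc (p - h • f' p)]
    calc G ^ 2 = 4 * K * (h * (G ^ 2 / 2)) := by linear_combination (-2 * G ^ 2) * hKh
      _ ≤ 4 * K * (f p - c) := by gcongr
  set D := f p - c with hD
  have hD0 : 0 ≤ D := sub_nonneg.mpr (hc p)
  set B := √(4 * L₀ * D) with hB
  have hB0 : 0 ≤ B := Real.sqrt_nonneg _
  have hB2 : B ^ 2 = 4 * L₀ * D := Real.sq_sqrt (by positivity)
  have hbound : G ≤ 2 * (4 * L₁ * D + B) := by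
    by_contra! hlt
    have hLD : 0 ≤ L₁ * D := by positivity
    nlinarith [mul_nonneg hLD hB0]
  nlinarith

/-- A real sequence driven by `u (s + 1) = β * u s + a s` with `|a s| ≤ η` and `u 0 = 0` stays
bounded by `η / (1 - β)`. -/
theorem abs_le_div_one_sub_of_recurrence {β η : ℝ} (hβ0 : 0 ≤ β) (hβ1 : β < 1)
    {u a : ℕ → ℝ} (hu0 : u 0 = 0) (hu : ∀ s, u (s + 1) = β * u s + a s)
    (ha : ∀ s, |a s| ≤ η) (s : ℕ) : |u s| ≤ η / (1 - β) := by
  have h1 : 0 < 1 - β := by linarith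
  induction s with
  | zero =>
    rw [hu0, abs_zero]
    exact div_nonneg ((abs_nonneg _).trans (ha 0)) h1.le
  | succ s ih =>
    calc |u (s + 1)| ≤ β * |u s| + |a s| := by
          rw [hu]
          exact (abs_add_le _ _).trans_eq (by rw [abs_mul, abs_of_nonneg hβ0])
      _ ≤ β * (η / (1 - β)) + η := by gcongr; exact ha s
      _ = η / (1 - β) := by field_simp; ring

theorem EuclideanSpace.norm_le_sqrt_card_mul {ι : Type*} [Fintype ι] {w : EuclideanSpace ℝ ι}
    {c : ℝ} (hc : 0 ≤ c) (hw : ∀ i, |w i| ≤ c) : ‖w‖ ≤ √(Fintype.card ι) * c := by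
  rw [EuclideanSpace.norm_eq, ← Real.sqrt_sq hc, ← Real.sqrt_mul (Nat.cast_nonneg _)]
  refine Real.sqrt_le_sqrt ?_
  calc ∑ i, ‖w i‖ ^ 2 ≤ ∑ _i : ι, c ^ 2 :=
        Finset.sum_le_sum fun i _ => pow_le_pow_left₀ (norm_nonneg _) (hw i) 2
    _ = Fintype.card ι * c ^ 2 := by simp

theorem stmt_15
    {d : ℕ} (β η ε : ℝ) (hβ0 : 0 ≤ β) (hβ1 : β < 1) (hη : 0 < η) (hε : 0 < ε)
    (g v m x : ℕ → EuclideanSpace ℝ (Fin d))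
    (hv0 : v 0 = 0) (hm0 : m 0 = 0) (hx0 : x 0 = x 1)
    (hv : ∀ s, 1 ≤ s → ∀ i, v s i = v (s - 1) i + g s i ^ 2)
    (hmrec : ∀ s, 1 ≤ s → ∀ i,
      m s i = β * m (s - 1) i - η * g s i / (Real.sqrt (v s i) + ε))
    (hxrec : ∀ s, 1 ≤ s → x (s + 1) = x s + m s)
    (f : EuclideanSpace ℝ (Fin d) → ℝ) (fgrad : EuclideanSpace ℝ (Fin d) → EuclideanSpace ℝ (Fin d))
    (hgrad : ∀ p, HasGradientAt f (fgrad p) p)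
    (L₀ L₁ : ℝ) (hL₀ : 0 < L₀) (hL₁ : 0 < L₁)
    (hgen : ∀ p q, ‖p - q‖ ≤ 1 / L₁ →
      ‖fgrad q - fgrad p‖ ≤ (L₀ + L₁ * ‖fgrad p‖) * ‖p - q‖)
    (fstar : ℝ) (hfstar : ∀ p, fstar ≤ f p)
    (hηgen : η ≤ (1 - β) ^ 2 / (L₁ * Real.sqrt (d : ℝ)))
    (y : ℕ → EuclideanSpace ℝ (Fin d))
    (hy1 : y 1 = x 1)
    (hy : ∀ s, 2 ≤ s → y s = x s + (β / (1 - β)) • (x s - x (s - 1)))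
    (Ls : ℕ → ℝ)
    (hLs : ∀ s, Ls s = 2 * L₀ + 2 * L₁ *
      (4 * L₁ * (f (x s) - fstar) + Real.sqrt (4 * L₀ * (f (x s) - fstar))))
    (b : ℕ → Fin d → ℝ)
    (hb : ∀ s i, b s i = Real.sqrt (v s i) + ε)
 :
    ∀ t, 1 ≤ t →
      ∑ s ∈ Finset.Icc 1 t, ∑ i, (fgrad (x s) i - fgrad (y s) i) * (g s i / b s i) ≤
        ∑ s ∈ Finset.Icc 1 t, Ls s / (2 * η) * ‖m (s - 1)‖ ^ 2 +
          ∑ s ∈ Finset.Icc 1 t, Ls s * η / (2 * (1 - β) ^ 2) * ∑ i, g s i ^ 2 / b s i ^ 2 := by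
  have h1β : 0 < 1 - β := by linarith
  have hv_nonneg (s : ℕ) (i : Fin d) : 0 ≤ v s i := by
    induction s with
    | zero => simp [hv0]
    | succ s ih =>
      rw [hv (s + 1) (by omega) i, Nat.add_sub_cancel]
      positivity
  have hb_pos (s : ℕ) (i : Fin d) : 0 < √(v s i) + ε := by positivity
  have hratio (s : ℕ) (i : Fin d) : |-(η * g (s + 1) i / (√(v (s + 1) i) + ε))| ≤ η := by
    have hg : |g (s + 1) i| ≤ √(v (s + 1) i) := by
      refine Real.abs_le_sqrt ?_
      rw [hv (s + 1) (by omega) i]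
      linarith [hv_nonneg (s + 1 - 1) i]
    rw [abs_neg, abs_div, abs_mul, abs_of_pos hη, abs_of_pos (hb_pos _ _),
      div_le_iff₀ (hb_pos _ _)]
    gcongr
    linarith
  have hm_coord (s : ℕ) (i : Fin d) : |m s i| ≤ η / (1 - β) :=
    abs_le_div_one_sub_of_recurrence hβ0 hβ1 (u := fun s => m s i)
      (a := fun s => -(η * g (s + 1) i / (√(v (s + 1) i) + ε))) (by simp [hm0])
      (fun s => by simp only [hmrec (s + 1) (by omega) i, Nat.add_sub_cancel]; ring)
      (fun s => hratio s i) s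
  have hm_norm (s : ℕ) : ‖m s‖ ≤ √d * (η / (1 - β)) := by
    simpa using EuclideanSpace.norm_le_sqrt_card_mul (div_nonneg hη.le h1β.le) (hm_coord s)
  have hd : 0 < √(d : ℝ) := by
    refine (Real.sqrt_nonneg _).lt_of_ne fun h => ?_
    rw [← h] at hηgen
    simp at hηgen
    linarith
  have hyx (s : ℕ) (hs : 1 ≤ s) : y s - x s = (β / (1 - β)) • m (s - 1) := by
    obtain rfl | hs2 := hs.eq_or_lt
    · simp [hy1, hm0]
    · have h := hxrec (s - 1) (by omega)
      rw [Nat.sub_add_cancel hs] at h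
      rw [hy s hs2, add_sub_cancel_left, h, add_sub_cancel_left]
  have hyx_norm (s : ℕ) (hs : 1 ≤ s) : ‖x s - y s‖ = β / (1 - β) * ‖m (s - 1)‖ := by
    rw [norm_sub_rev, hyx s hs, norm_smul, Real.norm_of_nonneg (by positivity)]
  have hclose (s : ℕ) (hs : 1 ≤ s) : ‖x s - y s‖ ≤ 1 / L₁ := by
    rw [hyx_norm s hs]
    have h : √d * (η / (1 - β)) ≤ (1 - β) / L₁ := by
      rw [le_div_iff₀ (by positivity)] at hηgen
      rw [mul_div_assoc', div_le_div_iff₀ h1β hL₁]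
      nlinarith
    calc β / (1 - β) * ‖m (s - 1)‖ ≤ β / (1 - β) * ((1 - β) / L₁) := by
          gcongr; exact (hm_norm _).trans h
      _ = β / L₁ := by field_simp
      _ ≤ 1 / L₁ := by gcongr
  intro t _
  rw [← Finset.sum_add_distrib]
  refine Finset.sum_le_sum fun s hs => ?_
  have hs : 1 ≤ s := (Finset.mem_Icc.mp hs).1
  have hLs_bound : L₀ + L₁ * ‖fgrad (x s)‖ ≤ Ls s := by
    rw [hLs]
    exact local_smoothness_le_of_bddBelow hgrad hL₀ hL₁ hgen hfstar (x s)
  have hLs0 : 0 ≤ Ls s := le_trans (by positivity) hLs_bound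
  set w : EuclideanSpace ℝ (Fin d) := WithLp.toLp 2 fun i => g s i / b s i with hw
  have hw_norm : ∑ i, g s i ^ 2 / b s i ^ 2 = ‖w‖ ^ 2 := by
    simp [EuclideanSpace.norm_sq_eq, hw, div_pow]
  have hw_inner : ∑ i, (fgrad (x s) i - fgrad (y s) i) * (g s i / b s i) =
      inner ℝ (fgrad (x s) - fgrad (y s)) w := by
    simp [PiLp.inner_apply, hw, mul_comm]
  rw [hw_norm, hw_inner]
  calc inner ℝ (fgrad (x s) - fgrad (y s)) w
      ≤ ‖fgrad (x s) - fgrad (y s)‖ * ‖w‖ := real_inner_le_norm _ _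
    _ ≤ (Ls s * ‖x s - y s‖) * ‖w‖ := by
        gcongr
        rw [norm_sub_rev]
        exact (hgen _ _ (hclose s hs)).trans (by gcongr)
    _ ≤ (Ls s * (1 / (1 - β) * ‖m (s - 1)‖)) * ‖w‖ := by
        rw [hyx_norm s hs]
        gcongr
    _ = Ls s * (‖m (s - 1)‖ * (‖w‖ / (1 - β))) := by ring
    _ ≤ Ls s * (‖m (s - 1)‖ ^ 2 / (2 * η) + η * (‖w‖ / (1 - β)) ^ 2 / 2) := by
        gcongr
        rw [← sub_nonneg]
        have : ‖m (s - 1)‖ ^ 2 / (2 * η) + η * (‖w‖ / (1 - β)) ^ 2 / 2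
            - ‖m (s - 1)‖ * (‖w‖ / (1 - β))
            = (‖m (s - 1)‖ - η * (‖w‖ / (1 - β))) ^ 2 / (2 * η) := by
          field_simp
          ring
        rw [this]
        positivity
    _ = Ls s / (2 * η) * ‖m (s - 1)‖ ^ 2 + Ls s * η / (2 * (1 - β) ^ 2) * ‖w‖ ^ 2 := by
        field_simp
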